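/- Let R be a commutative ring and A an R-algebra. Then the following are equivalent: (1) for every commutative ring R' and every ring homomorphism R → R', the R'-algebra A ⊗_R R' is R'-futile; (2) A is a quotient of R, i.e. the structure map R → A is surjective. -/

import Mathlib

universe u

open scoped TensorProduct

/-- An `R`-algebra `A` is *futile* if it has only finitely many `R`-subalgebras. -/
def IsFutile (R A : Type*) [CommRing R] [Ring A] [Algebra R A] : Prop :=
  Finite (Subalgebra R A)

section

open Polynomial

variable (R A : Type*) [CommRing R] [Ring A] [Algebra R A]

/-- The canonical `R`-algebra homomorphism `R[X] ⊗[R] A → A[X]`. -/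
noncomputable def tensorToPolynomial : R[X] ⊗[R] A →ₐ[R] A[X] :=
  Algebra.TensorProduct.lift (mapAlgHom (Algebra.ofId R A)) CAlgHom fun p a => by
    ext n
    simp [coeff_map, Algebra.commutes]

@[simp]
lemma tensorToPolynomial_tmul (p : R[X]) (a : A) :
    tensorToPolynomial R A (p ⊗ₜ a) = p.map (algebraMap R A) * C a :=
  Algebra.TensorProduct.lift_tmul _ _ _ _ _

/-- The `R[X]`-subalgebra of `R[X] ⊗[R] A` of the elements whose image in `A[X]` has all
coefficients of degree less than `n` in the image of `R`. -/
noncomputable def scalarCoeffSubalgebra (n : ℕ) : Subalgebra R[X] (R[X] ⊗[R] A) where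
  carrier := {z | ∀ m < n, (tensorToPolynomial R A z).coeff m ∈ (⊥ : Subalgebra R A)}
  mul_mem' {x y} hx hy m hm := by
    rw [map_mul, coeff_mul]
    refine sum_mem fun i hi => ?_
    have := Finset.HasAntidiagonal.mem_antidiagonal.mp hi
    exact mul_mem (hx _ (by lia)) (hy _ (by lia))
  add_mem' {x y} hx hy m hm := by
    rw [map_add, coeff_add]
    exact add_mem (hx m hm) (hy m hm)
  algebraMap_mem' p m _ := by
    refine Algebra.mem_bot.mpr ⟨p.coeff m, ?_⟩
    simp

variable {R A}

lemma X_pow_tmul_mem_scalarCoeffSubalgebra_iff {a : A} (ha : a ∉ (⊥ : Subalgebra R A))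
    {k n : ℕ} : ((X ^ k) ⊗ₜ a : R[X] ⊗[R] A) ∈ scalarCoeffSubalgebra R A n ↔ n ≤ k := by
  have hcoeff (m : ℕ) :
      (tensorToPolynomial R A ((X ^ k) ⊗ₜ a)).coeff m = if m = k then a else 0 := by
    simp [coeff_X_pow]
  change (∀ m < n, _ ∈ (⊥ : Subalgebra R A)) ↔ _
  simp only [hcoeff]
  refine ⟨fun h => ?_, fun h m hm => ?_⟩
  · by_contra! hk
    exact ha (by simpa using h k hk)
  · rw [if_neg (by lia)]
    exact zero_mem _

/-- If the base change of `A` to `R[X]` is futile, then `R → A` is surjective. -/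
lemma IsFutile.surjective_of_polynomial (h : IsFutile R[X] (R[X] ⊗[R] A)) :
    Function.Surjective (algebraMap R A) := by
  intro a
  by_contra ha
  rw [← Set.mem_range, ← Algebra.mem_bot] at ha
  have : Finite (Subalgebra R[X] (R[X] ⊗[R] A)) := h
  refine not_injective_infinite_finite (scalarCoeffSubalgebra R A) fun m n hmn => ?_
  have key (k : ℕ) : m ≤ k ↔ n ≤ k := by
    rw [← X_pow_tmul_mem_scalarCoeffSubalgebra_iff ha, hmn,
      X_pow_tmul_mem_scalarCoeffSubalgebra_iff ha]
  exact le_antisymm ((key n).mpr le_rfl) ((key m).mp le_rfl)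

/-- An algebra with surjective structure map is futile. -/
lemma IsFutile.of_surjective (h : Function.Surjective (algebraMap R A)) : IsFutile R A := by
  have htop (S : Subalgebra R A) : S = ⊤ :=
    top_le_iff.mp fun a _ => by
      obtain ⟨r, rfl⟩ := h a
      exact S.algebraMap_mem r
  have : Subsingleton (Subalgebra R A) := ⟨fun S T => (htop S).trans (htop T).symm⟩
  exact Finite.of_subsingleton

/-- Surjectivity of the structure map is stable under base change. -/
lemma algebraMap_tensorProduct_surjective (R' : Type*) [CommRing R'] [Algebra R R']
    (h : Function.Surjective (algebraMap R A)) :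
    Function.Surjective (algebraMap R' (R' ⊗[R] A)) := by
  intro z
  induction z with
  | zero => exact ⟨0, map_zero _⟩
  | add x y hx hy =>
    obtain ⟨⟨r, rfl⟩, s, rfl⟩ := And.intro hx hy
    exact ⟨r + s, map_add _ _ _⟩
  | tmul r a =>
    obtain ⟨s, rfl⟩ := h a
    refine ⟨s • r, ?_⟩
    rw [Algebra.TensorProduct.algebraMap_apply, Algebra.algebraMap_self_apply,
      TensorProduct.smul_tmul, Algebra.algebraMap_eq_smul_one]

end

/-- For an `R`-algebra `A`, every base change `A ⊗_R R'` is an `R'`-futile `R'`-algebra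
(for every ring homomorphism `R → R'`) if and only if the structure map `R → A` is
surjective, i.e. `A` is a quotient of `R`. -/
theorem all_base_changes_futile_iff_surjective
    {R A : Type u} [CommRing R] [Ring A] [Algebra R A] :
    (∀ (R' : Type u) [CommRing R'] (f : R →+* R'),
        letI := f.toAlgebra
        IsFutile R' (R' ⊗[R] A)) ↔
      Function.Surjective (algebraMap R A) := by
  refine ⟨fun h => ?_, fun h R' _ f => ?_⟩
  · have hX := h (Polynomial R) (algebraMap R (Polynomial R))
    rw [show (algebraMap R (Polynomial R)).toAlgebra = Polynomial.algebraOfAlgebra from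
      Algebra.algebra_ext _ _ fun _ => rfl] at hX
    exact hX.surjective_of_polynomial
  · let := f.toAlgebra
    exact .of_surjective (algebraMap_tensorProduct_surjective R' h)
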